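/- (Deterministic stochastic-error bound.) Let H be a real Hilbert space, let C₀ and Ĉ₀ be bounded self-adjoint positive operators on H, let Ψ, C₁, Ĉ₁ be bounded operators with C₁ = Ψ ∘ C₀, let α > 0, and let δ ≥ 0 satisfy ‖Ĉ₀ − C₀‖_op ≤ δ and ‖Ĉ₁ − C₁‖_op ≤ δ. Define Ψ̂_α = Ĉ₁ ∘ (Ĉ₀ + αI)⁻¹ and Ψ_α = C₁ ∘ (C₀ + αI)⁻¹. Then ‖Ψ̂_α − Ψ_α‖_op ≤ (δ/α) · (1 + ‖Ψ‖_op · (1 + δ/α)). -/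

import Mathlib

open scoped RealInnerProductSpace

section ResolventBounds

variable {H : Type*} [NormedAddCommGroup H] [InnerProductSpace ℝ H]

theorem norm_sq_add_smul_ge {C : H →L[ℝ] H} (hC : ∀ x : H, 0 ≤ ⟪C x, x⟫)
    {α : ℝ} (hα : 0 ≤ α) (y : H) :
    ‖C y‖ ^ 2 + (α * ‖y‖) ^ 2 ≤ ‖C y + α • y‖ ^ 2 := by
  rw [norm_add_sq_real, real_inner_smul_right, norm_smul, Real.norm_of_nonneg hα]
  linarith [mul_nonneg hα (hC y)]

variable {C R : H →L[ℝ] H} {α : ℝ}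

theorem norm_mul_resolvent_le_one (hC : ∀ x : H, 0 ≤ ⟪C x, x⟫) (hα : 0 ≤ α)
    (hR : (C + α • 1) * R = 1) : ‖C * R‖ ≤ 1 := by
  refine ContinuousLinearMap.opNorm_le_bound _ zero_le_one fun x => ?_
  have hx : C (R x) + α • R x = x := DFunLike.congr_fun hR x
  have h := norm_sq_add_smul_ge hC hα (R x)
  rw [hx] at h
  change ‖C (R x)‖ ≤ 1 * ‖x‖
  rw [one_mul]
  exact le_of_pow_le_pow_left₀ two_ne_zero (norm_nonneg x) (by linarith [sq_nonneg (α * ‖R x‖)])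

theorem norm_resolvent_le_inv (hC : ∀ x : H, 0 ≤ ⟪C x, x⟫) (hα : 0 < α)
    (hR : (C + α • 1) * R = 1) : ‖R‖ ≤ α⁻¹ := by
  refine ContinuousLinearMap.opNorm_le_bound _ (inv_nonneg.mpr hα.le) fun x => ?_
  have hx : C (R x) + α • R x = x := DFunLike.congr_fun hR x
  have h := norm_sq_add_smul_ge hC hα.le (R x)
  rw [hx] at h
  rw [le_inv_mul_iff₀ hα]
  exact le_of_pow_le_pow_left₀ two_ne_zero (norm_nonneg x) (by linarith [sq_nonneg ‖C (R x)‖])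

end ResolventBounds

/-- Deterministic stochastic-error bound: with `C₁ = Ψ ∘ C₀`, `‖Ĉ₀ − C₀‖ ≤ δ`,
`‖Ĉ₁ − C₁‖ ≤ δ`, and `R`, `Rhat` the bounded inverses of `C₀ + αI` and `Ĉ₀ + αI`
respectively, the sample and population Tikhonov operators `Ψ̂_α = Ĉ₁ ∘ (Ĉ₀ + αI)⁻¹`
and `Ψ_α = C₁ ∘ (C₀ + αI)⁻¹` satisfy
`‖Ψ̂_α − Ψ_α‖ ≤ (δ/α) · (1 + ‖Ψ‖ · (1 + δ/α))`. -/
theorem tikhonov_stochastic_error_bound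
    {H : Type*} [NormedAddCommGroup H] [InnerProductSpace ℝ H] [CompleteSpace H]
    (C₀ Chat₀ Ψ C₁ Chat₁ R Rhat : H →L[ℝ] H)
    (hC₀ : IsSelfAdjoint C₀) (hC₀pos : ∀ x : H, 0 ≤ ⟪C₀ x, x⟫)
    (hChat₀ : IsSelfAdjoint Chat₀) (hChat₀pos : ∀ x : H, 0 ≤ ⟪Chat₀ x, x⟫)
    (hmom : C₁ = Ψ * C₀)
    (α δ : ℝ) (hα : 0 < α) (hδ : 0 ≤ δ)
    (hδ0 : ‖Chat₀ - C₀‖ ≤ δ) (hδ1 : ‖Chat₁ - C₁‖ ≤ δ)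
    (hR1 : R * (C₀ + α • 1) = 1) (hR2 : (C₀ + α • 1) * R = 1)
    (hRhat1 : Rhat * (Chat₀ + α • 1) = 1) (hRhat2 : (Chat₀ + α • 1) * Rhat = 1) :
    ‖Chat₁ * Rhat - C₁ * R‖ ≤ (δ / α) * (1 + ‖Ψ‖ * (1 + δ / α)) := by
  have hRR : Rhat - R = R * (C₀ - Chat₀) * Rhat := by
    calc Rhat - R = R * (C₀ + α • 1) * Rhat - R * ((Chat₀ + α • 1) * Rhat) := by
          rw [hR1, hRhat2, one_mul, mul_one]
      _ = R * (C₀ - Chat₀) * Rhat := by noncomm_ring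
  have hdecomp : Chat₁ * Rhat - C₁ * R =
      (Chat₁ - C₁) * Rhat + Ψ * (C₀ * R) * (C₀ - Chat₀) * Rhat := by
    calc Chat₁ * Rhat - C₁ * R = (Chat₁ - C₁) * Rhat + C₁ * (Rhat - R) := by noncomm_ring
      _ = _ := by rw [hRR, hmom]; simp only [mul_assoc]
  have hRhat := norm_resolvent_le_inv hChat₀pos hα hRhat2
  have hCR := norm_mul_resolvent_le_one hC₀pos hα.le hR2
  rw [norm_sub_rev] at hδ0
  have hfirst : ‖(Chat₁ - C₁) * Rhat‖ ≤ δ * α⁻¹ := norm_mul_le_of_le hδ1 hRhat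
  have hsecond : ‖Ψ * (C₀ * R) * (C₀ - Chat₀) * Rhat‖ ≤ ‖Ψ‖ * 1 * δ * α⁻¹ :=
    norm_mul_le_of_le (norm_mul_le_of_le (norm_mul_le_of_le le_rfl hCR) hδ0) hRhat
  have hslack : 0 ≤ ‖Ψ‖ * (δ / α) ^ 2 := by positivity
  rw [hdecomp]
  calc _ ≤ δ * α⁻¹ + ‖Ψ‖ * 1 * δ * α⁻¹ := norm_add_le_of_le hfirst hsecond
    _ = (δ / α) * (1 + ‖Ψ‖ * (1 + δ / α)) - ‖Ψ‖ * (δ / α) ^ 2 := by ring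
    _ ≤ _ := sub_le_self _ hslack
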